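/- Let a ≥ 1 be a real number. The double series Z(s) = ∑_{m=1}^∞ ∑_{n=1}^∞ n·((a m + n)² − 1)^{-s} converges absolutely for Re(s) > 2, and every analytic continuation f of this series to the point 0 satisfies f(0) = −5/24 (in particular the value is independent of a). -/

import Mathlib

/-- `f` is an analytic continuation to `s₀` of the function `F` given (by an absolutely
convergent series) on the half-plane `{s : Re s > c}`. -/
def IsContinuationAt (F : ℂ → ℂ) (c : ℝ) (s₀ : ℂ) (f : ℂ → ℂ) : Prop :=
  ∃ U : Set ℂ, IsOpen U ∧ IsConnected U ∧ s₀ ∈ U ∧ {s : ℂ | c < s.re} ⊆ U ∧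
    AnalyticOnNhd ℂ f U ∧ ∀ s : ℂ, c < s.re → f s = F s

section LatticeZeta

open Complex Set Filter Topology MeasureTheory

/-- An analytic function at `0` has Taylor expansions with analytic remainder, to every order. -/
theorem exists_taylor_remainder {f : ℝ → ℝ} (hf : AnalyticAt ℝ f 0) :
    ∃ c : ℕ → ℝ, ∀ n : ℕ, ∃ h : ℝ → ℝ, AnalyticAt ℝ h 0 ∧
      ∀ t, f t = ∑ j ∈ Finset.range n, c j * t ^ j + t ^ n * h t := by
  have han : ∀ n : ℕ, AnalyticAt ℝ ((Function.swap dslope 0)^[n] f) 0 := by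
    obtain ⟨p, hp⟩ := hf
    exact fun n => (hp.has_fpower_series_iterate_dslope_fslope n).analyticAt
  refine ⟨fun j => (Function.swap dslope 0)^[j] f 0, fun n => ⟨_, han n, fun t => ?_⟩⟩
  induction n with
  | zero => simp
  | succ n ih =>
    have h := sub_smul_dslope ((Function.swap dslope 0)^[n] f) 0 t
    rw [ih, Finset.sum_range_succ, Function.iterate_succ_apply']
    simp only [sub_zero, smul_eq_mul, Function.swap] at h ⊢
    rw [pow_succ, mul_assoc, h]
    ring

theorem exists_exp_remainder : ∃ e : ℝ → ℝ, AnalyticAt ℝ e 0 ∧ ∀ᶠ t in 𝓝 (0 : ℝ),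
    Real.exp t = 1 + t + t ^ 2 / 2 + t ^ 3 / 6 + t ^ 4 / 24 + t ^ 5 * e t := by
  obtain ⟨e, he, h⟩ := (natCast_le_analyticOrderAt (n := 5)
    (f := fun t : ℝ => Real.exp t - (1 + t + t ^ 2 / 2 + t ^ 3 / 6 + t ^ 4 / 24)) (z₀ := 0)
    (by fun_prop)).1 <| by
      refine (natCast_le_analyticOrderAt_iff_iteratedDeriv_eq_zero (by fun_prop)).2 fun i hi => ?_
      have h1 : deriv (fun t : ℝ => Real.exp t - (1 + t + t ^ 2 / 2 + t ^ 3 / 6 + t ^ 4 / 24)) =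
          fun t => Real.exp t - (1 + t + t ^ 2 / 2 + t ^ 3 / 6) := by
        ext t
        refine HasDerivAt.deriv (((Real.hasDerivAt_exp t).sub (((((hasDerivAt_const t 1).add
          (hasDerivAt_id t)).add ((hasDerivAt_pow 2 t).div_const 2)).add
          ((hasDerivAt_pow 3 t).div_const 6)).add
          ((hasDerivAt_pow 4 t).div_const 24))).congr_deriv ?_)
        push_cast; ring
      have h2 : deriv (fun t : ℝ => Real.exp t - (1 + t + t ^ 2 / 2 + t ^ 3 / 6)) =
          fun t => Real.exp t - (1 + t + t ^ 2 / 2) := by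
        ext t
        refine HasDerivAt.deriv (((Real.hasDerivAt_exp t).sub ((((hasDerivAt_const t 1).add
          (hasDerivAt_id t)).add ((hasDerivAt_pow 2 t).div_const 2)).add
          ((hasDerivAt_pow 3 t).div_const 6))).congr_deriv ?_)
        push_cast; ring
      have h3 : deriv (fun t : ℝ => Real.exp t - (1 + t + t ^ 2 / 2)) =
          fun t => Real.exp t - (1 + t) := by
        ext t
        refine HasDerivAt.deriv (((Real.hasDerivAt_exp t).sub (((hasDerivAt_const t 1).add
          (hasDerivAt_id t)).add ((hasDerivAt_pow 2 t).div_const 2))).congr_deriv ?_)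
        push_cast; ring
      have h4 : deriv (fun t : ℝ => Real.exp t - (1 + t)) = fun t => Real.exp t - 1 := by
        ext t
        refine HasDerivAt.deriv (((Real.hasDerivAt_exp t).sub ((hasDerivAt_const t 1).add
          (hasDerivAt_id t))).congr_deriv ?_)
        ring
      interval_cases i <;> simp [iteratedDeriv_succ', h1, h2, h3, h4]
  refine ⟨e, he, h.mono fun t ht => ?_⟩
  simp only [sub_zero, smul_eq_mul] at ht
  linarith

/-- The expansion `1 / (eˣ - 1) = 1 / x - 1 / 2 + x / 12 + O(x³)`. -/
theorem exists_bernoulli_remainder : ∃ b : ℝ → ℝ, AnalyticAt ℝ b 0 ∧ ∀ᶠ t in 𝓝 (0 : ℝ),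
    0 < t → (Real.exp t - 1)⁻¹ = (1 - t / 2 + t ^ 2 / 12 + t ^ 4 * b t) / t := by
  obtain ⟨e, he, h⟩ := exists_exp_remainder
  refine ⟨fun t => (1 / 144 - t / 288 - (1 - t / 2 + t ^ 2 / 12) * e t) /
    (1 + t / 2 + t ^ 2 / 6 + t ^ 3 / 24 + t ^ 4 * e t), ?_, ?_⟩
  · refine AnalyticAt.div (by fun_prop) (by fun_prop) (by simp)
  · filter_upwards [h] with t ht h0
    have h1 : Real.exp t - 1 = t * (1 + t / 2 + t ^ 2 / 6 + t ^ 3 / 24 + t ^ 4 * e t) := by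
      rw [ht]; ring
    have h2 : 0 < Real.exp t - 1 := by linarith [Real.add_one_lt_exp h0.ne']
    have h3 : 0 < 1 + t / 2 + t ^ 2 / 6 + t ^ 3 / 24 + t ^ 4 * e t := by
      rw [h1] at h2; exact pos_of_mul_pos_right h2 h0.le
    rw [h1]
    obtain ⟨D, hD⟩ : ∃ D, D = 1 + t / 2 + t ^ 2 / 6 + t ^ 3 / 24 + t ^ 4 * e t := ⟨_, rfl⟩
    rw [← hD] at h3 ⊢
    field_simp
    rw [hD]
    ring

/-- The generating function `∑ n e^{-(am+n)t}` as a function of `t`. -/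
noncomputable def expSum (a t : ℝ) : ℝ :=
  (Real.exp (a * t) - 1)⁻¹ * ((Real.exp t - 1)⁻¹ + (Real.exp t - 1)⁻¹ ^ 2)

theorem exists_expSum_expansion {a : ℝ} (ha : 0 < a) :
    ∃ c : ℕ → ℝ, c 1 = -1 / 2 ∧ c 3 = 1 / 24 ∧ ∀ n : ℕ, 4 ≤ n →
      ∃ h : ℝ → ℝ, AnalyticAt ℝ h 0 ∧ ∀ᶠ t in 𝓝 (0 : ℝ), 0 < t →
        t ^ 3 * expSum a t = ∑ j ∈ Finset.range n, c j * t ^ j + t ^ n * h t := by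
  obtain ⟨b, hb, h⟩ := exists_bernoulli_remainder
  let B : ℝ → ℝ := fun t => b (a * t)
  have hba : AnalyticAt ℝ B 0 :=
    AnalyticAt.fun_comp (by simpa using hb) (by fun_prop)
  let Q : ℝ → ℝ := fun t => 1 / 144 + t * b t + 2 * (1 - t / 2 + t ^ 2 / 12) * b t + t ^ 4 * b t ^ 2
  let R : ℝ → ℝ := fun t => (-a ^ 2 / 144 + (1 - a * t / 2 + a ^ 2 * t ^ 2 / 12) * Q t
    + a ^ 4 * B t * (1 - t ^ 2 / 12) + a ^ 4 * B t * t ^ 4 * Q t) / a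
  have hQ : AnalyticAt ℝ Q 0 := by fun_prop
  have hR : AnalyticAt ℝ R 0 := by fun_prop
  obtain ⟨d, hd⟩ := exists_taylor_remainder hR
  let c : ℕ → ℝ
    | 0 => 1 / a
    | 1 => -1 / 2
    | 2 => a / 12 - 1 / (12 * a)
    | 3 => 1 / 24
    | k + 4 => d k
  refine ⟨c, rfl, rfl, fun n hn => ?_⟩
  obtain ⟨k, rfl⟩ := Nat.exists_eq_add_of_le hn
  obtain ⟨g, hg, hgR⟩ := hd k
  refine ⟨g, hg, ?_⟩
  have ht : Tendsto (fun t : ℝ => a * t) (𝓝 0) (𝓝 0) := by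
    simpa using (continuous_const_mul a).tendsto (0 : ℝ)
  filter_upwards [h, ht.eventually h] with t h1 h2 h0
  have h3 : t ^ 3 * expSum a t = 1 / a + -1 / 2 * t + (a / 12 - 1 / (12 * a)) * t ^ 2
      + 1 / 24 * t ^ 3 + t ^ 4 * R t := by
    rw [expSum, h1 h0, h2 (by positivity)]
    simp only [R, Q, B]
    field_simp
    ring
  have h4 : ∑ j ∈ Finset.range (4 + k), c j * t ^ j = 1 / a + -1 / 2 * t
      + (a / 12 - 1 / (12 * a)) * t ^ 2 + 1 / 24 * t ^ 3
      + t ^ 4 * ∑ j ∈ Finset.range k, d j * t ^ j := by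
    rw [Finset.sum_range_add, Finset.mul_sum]
    congr 1
    · simp [Finset.sum_range_succ, c]
    · refine Finset.sum_congr rfl fun j _ => ?_
      rw [add_comm 4 j]
      simp only [c]
      ring
  rw [h3, h4, hgR]
  ring

theorem hasMellin_sum_cpow_Ioc (s : Finset ℕ) (c e : ℕ → ℂ) {w : ℂ}
    (hw : ∀ j ∈ s, 0 < w.re + (e j).re) :
    HasMellin (fun t => ∑ j ∈ s, c j • indicator (Ioc 0 1) (fun t : ℝ => (t : ℂ) ^ e j) t) w
      (∑ j ∈ s, c j / (w + e j)) := by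
  induction s using Finset.induction_on with
  | empty => simp [HasMellin, MellinConvergent, mellin]
  | insert i s hi ih =>
    obtain ⟨h1, h2⟩ := ih fun j hj => hw j (Finset.mem_insert_of_mem hj)
    obtain ⟨h3, h4⟩ := hasMellin_cpow_Ioc (e i) (hw i (Finset.mem_insert_self i s))
    have h5 := hasMellin_add (h3.const_smul (c i)) h1
    rw [mellin_const_smul, h4, h2] at h5
    simpa only [Finset.sum_insert hi, smul_eq_mul, mul_one_div] using h5

/-- The Mellin transform of a function which decays exponentially at infinity and has an asymptotic
expansion in integer powers at `0` continues meromorphically. -/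
theorem exists_mellin_continuation {φ : ℝ → ℂ} (hφ : ContinuousOn φ (Ioi 0)) {r : ℝ} (hr : 0 < r)
    (htop : φ =O[atTop] fun t => Real.exp (-r * t)) {d n : ℕ} {c : ℕ → ℂ}
    (hbot : (fun t : ℝ => φ t - ∑ j ∈ Finset.range n, c j * (t : ℂ) ^ ((j : ℂ) - d))
      =O[𝓝[>] 0] fun t : ℝ => t ^ (-((d : ℝ) - n))) :
    ∃ H : ℂ → ℂ, (∀ w : ℂ, (d : ℝ) - n < w.re → DifferentiableAt ℂ H w) ∧ ∀ w : ℂ, d < w.re →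
      mellin φ w = ∑ j ∈ Finset.range n, c j / (w + ((j : ℂ) - d)) + H w := by
  let Ψ : ℝ → ℂ := fun t => ∑ j ∈ Finset.range n,
    c j • indicator (Ioc 0 1) (fun t : ℝ => (t : ℂ) ^ ((j : ℂ) - d)) t
  have hΨ : Ψ = indicator (Ioc 0 1)
      (fun t : ℝ => ∑ j ∈ Finset.range n, c j * (t : ℂ) ^ ((j : ℂ) - d)) := by
    ext t
    by_cases ht : t ∈ Ioc (0 : ℝ) 1 <;> simp [Ψ, ht]
  have hcont : ContinuousOn
      (fun t : ℝ => ∑ j ∈ Finset.range n, c j * (t : ℂ) ^ ((j : ℂ) - d)) (Ioi 0) := by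
    refine continuousOn_finsetSum _ fun j _ => continuousOn_const.mul fun t ht => ?_
    exact (continuousAt_ofReal_cpow_const _ _ (Or.inr (ne_of_gt ht))).continuousWithinAt
  have hloc : LocallyIntegrableOn (fun t => φ t - Ψ t) (Ioi 0) := by
    refine (hφ.locallyIntegrableOn measurableSet_Ioi).sub fun x hx => ?_
    obtain ⟨U, hU, h⟩ := hcont.locallyIntegrableOn (μ := volume) measurableSet_Ioi x hx
    rw [hΨ]
    exact ⟨U, hU, h.indicator measurableSet_Ioc⟩
  have htop' : (fun t => φ t - Ψ t) =O[atTop] fun t => Real.exp (-r * t) := by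
    refine htop.congr' ?_ EventuallyEq.rfl
    filter_upwards [eventually_gt_atTop (1 : ℝ)] with t ht
    simp [hΨ, ht]
  have hbot' : (fun t => φ t - Ψ t) =O[𝓝[>] 0] fun t : ℝ => t ^ (-((d : ℝ) - n)) := by
    refine hbot.congr' ?_ EventuallyEq.rfl
    filter_upwards [Ioc_mem_nhdsGT (zero_lt_one' ℝ)] with t ht
    rw [hΨ, indicator_of_mem ht]
  refine ⟨mellin fun t => φ t - Ψ t, fun w hw =>
    mellin_differentiableAt_of_isBigO_rpow_exp hr hloc htop' hbot' hw, fun w hw => ?_⟩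
  have h1 := mellinConvergent_of_isBigO_rpow_exp hr hloc htop' hbot'
    (s := w) (by have := n.cast_nonneg (α := ℝ); linarith)
  have h2 := hasMellin_sum_cpow_Ioc (Finset.range n) c (fun j => (j : ℂ) - d) (w := w)
    fun j _ => by
      have := j.cast_nonneg (α := ℝ)
      simp only [sub_re, natCast_re]; linarith
  have h3 := (hasMellin_add h1 h2.1).2
  simp only [Ψ, sub_add_cancel] at h3
  rw [h3, h2.2, add_comm]

/-- The numbers `a m + n` with `m, n ≥ 1`, indexed by pairs of natural numbers. -/
def latticePoint (a : ℝ) (p : ℕ × ℕ) : ℝ := a * (p.1 + 1) + (p.2 + 1)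

theorem two_le_latticePoint {a : ℝ} (ha : 1 ≤ a) (p : ℕ × ℕ) : 2 ≤ latticePoint a p := by
  have h1 := p.1.cast_nonneg (α := ℝ)
  have h2 := p.2.cast_nonneg (α := ℝ)
  unfold latticePoint
  nlinarith

theorem summable_latticePoint_rpow {a : ℝ} (ha : 1 ≤ a) {σ : ℝ} (hσ : 3 < σ) :
    Summable fun p : ℕ × ℕ => ((p.2 : ℝ) + 1) * latticePoint a p ^ (-σ) := by
  obtain ⟨α, hα, hασ⟩ : ∃ α : ℝ, 1 < α ∧ 2 < σ - α :=
    ⟨(σ - 1) / 2, by linarith, by linarith⟩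
  have hs : ∀ b : ℝ, 1 < b → Summable fun n : ℕ => ((n : ℝ) + 1) ^ (-b) := fun b hb => by
    simpa using (summable_nat_add_iff 1).2 (Real.summable_nat_rpow.2 (neg_lt_neg hb))
  refine Summable.of_nonneg_of_le (fun p => ?_) (fun p => ?_)
    ((hs α hα).mul_of_nonneg (hs (σ - α - 1) (by linarith))
      (fun n => by positivity) (fun n => by positivity))
  · have := two_le_latticePoint ha p
    positivity
  · have h1 := p.1.cast_nonneg (α := ℝ)
    have h2 := p.2.cast_nonneg (α := ℝ)
    have hx := two_le_latticePoint ha p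
    have hm : (p.1 : ℝ) + 1 ≤ latticePoint a p := by unfold latticePoint; nlinarith
    have hn : (p.2 : ℝ) + 1 ≤ latticePoint a p := by unfold latticePoint; nlinarith
    calc ((p.2 : ℝ) + 1) * latticePoint a p ^ (-σ)
        = ((p.2 : ℝ) + 1) * (latticePoint a p ^ (-α) * latticePoint a p ^ (-(σ - α))) := by
          rw [← Real.rpow_add (by linarith)]; ring_nf
      _ ≤ ((p.2 : ℝ) + 1) * (((p.1 : ℝ) + 1) ^ (-α) * ((p.2 : ℝ) + 1) ^ (-(σ - α))) := by
          gcongr ?_ * (?_ * ?_)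
          · exact Real.rpow_le_rpow_of_nonpos (by positivity) hm (by linarith)
          · exact Real.rpow_le_rpow_of_nonpos (by positivity) hn (by linarith)
      _ = ((p.1 : ℝ) + 1) ^ (-α) * ((p.2 : ℝ) + 1) ^ (-(σ - α - 1)) := by
          rw [show -(σ - α - 1) = 1 + -(σ - α) by ring, Real.rpow_add (by positivity),
            Real.rpow_one]
          ring

theorem hasSum_expSum {a t : ℝ} (ha : 0 < a) (ht : 0 < t) :
    HasSum (fun p : ℕ × ℕ => ((p.2 : ℝ) + 1) * Real.exp (-latticePoint a p * t))
      (expSum a t) := by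
  have hq : ∀ b : ℝ, 0 < b → Real.exp (-b) < 1 := fun b hb => by simpa using hb
  have h1 : HasSum (fun m : ℕ => Real.exp (-(a * t)) * Real.exp (-(a * t)) ^ m)
      (Real.exp (a * t) - 1)⁻¹ := by
    have h := (hasSum_geometric_of_lt_one (Real.exp_pos _).le (hq (a * t) (by positivity))).mul_left
      (Real.exp (-(a * t)))
    have he : Real.exp (-(a * t)) * (1 - Real.exp (-(a * t)))⁻¹ = (Real.exp (a * t) - 1)⁻¹ := by
      have : 1 < Real.exp (a * t) := by simpa using mul_pos ha ht
      rw [Real.exp_neg]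
      have : Real.exp (a * t) - 1 ≠ 0 := by linarith
      field_simp
    rwa [he] at h
  have h2 : HasSum (fun n : ℕ => ((n : ℝ) + 1) * Real.exp (-t) ^ (n + 1))
      ((Real.exp t - 1)⁻¹ + (Real.exp t - 1)⁻¹ ^ 2) := by
    have h := hasSum_coe_mul_geometric_of_norm_lt_one (r := Real.exp (-t))
      (by simpa using ht)
    rw [← hasSum_nat_add_iff' 1] at h
    have he : Real.exp (-t) / (1 - Real.exp (-t)) ^ 2 =
        (Real.exp t - 1)⁻¹ + (Real.exp t - 1)⁻¹ ^ 2 := by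
      have : 1 < Real.exp t := by simpa using ht
      rw [Real.exp_neg]
      have : Real.exp t - 1 ≠ 0 := by linarith
      field_simp
      ring
    simpa [he] using h
  have h3 := h1.mul h2 (h1.summable.mul_of_nonneg h2.summable (fun n => by positivity)
    (fun n => by positivity))
  have he : (fun p : ℕ × ℕ => ((p.2 : ℝ) + 1) * Real.exp (-latticePoint a p * t)) = fun p =>
      Real.exp (-(a * t)) * Real.exp (-(a * t)) ^ p.1 *
        (((p.2 : ℝ) + 1) * Real.exp (-t) ^ (p.2 + 1)) := by
    ext p
    rw [← pow_succ', ← Real.exp_nat_mul, ← Real.exp_nat_mul, mul_left_comm, ← Real.exp_add]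
    congr 2
    unfold latticePoint
    push_cast
    ring
  rwa [he]

/-- The Dirichlet series `∑ n (am+n)^{-w}`. -/
noncomputable def latticeSeries (a : ℝ) (w : ℂ) : ℂ :=
  ∑' p : ℕ × ℕ, ((p.2 : ℂ) + 1) * (latticePoint a p : ℂ) ^ (-w)

theorem norm_latticeSeries_term {a : ℝ} (ha : 1 ≤ a) (w : ℂ) (p : ℕ × ℕ) :
    ‖((p.2 : ℂ) + 1) * (latticePoint a p : ℂ) ^ (-w)‖ =
      ((p.2 : ℝ) + 1) * latticePoint a p ^ (-w.re) := by
  have := two_le_latticePoint ha p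
  rw [norm_mul, Complex.norm_cpow_eq_rpow_re_of_pos (by linarith)]
  congr 1
  exact_mod_cast Complex.norm_natCast (p.2 + 1)

theorem summable_latticeSeries {a : ℝ} (ha : 1 ≤ a) {w : ℂ} (hw : 3 < w.re) :
    Summable fun p : ℕ × ℕ => ((p.2 : ℂ) + 1) * (latticePoint a p : ℂ) ^ (-w) := by
  refine Summable.of_norm ?_
  simp_rw [norm_latticeSeries_term ha]
  exact summable_latticePoint_rpow ha hw

theorem mellin_expSum {a : ℝ} (ha : 1 ≤ a) {w : ℂ} (hw : 3 < w.re) :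
    mellin (fun t => (expSum a t : ℂ)) w = Gamma w * latticeSeries a w := by
  have hpos : ∀ p, 0 < latticePoint a p := fun p => by linarith [two_le_latticePoint ha p]
  have h := hasSum_mellin (a := fun p : ℕ × ℕ => (p.2 : ℂ) + 1) (p := latticePoint a)
    (F := fun t => (expSum a t : ℂ)) (s := w) (fun p => Or.inr (hpos p)) (by linarith)
    (fun t ht => by
      have := Complex.hasSum_ofReal.2 (hasSum_expSum (show 0 < a by linarith) ht)
      simpa using this) ?_
  · rw [← h.tsum_eq, latticeSeries, ← tsum_mul_left]
    refine tsum_congr fun p => ?_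
    rw [cpow_neg]
    ring
  · convert summable_latticePoint_rpow ha hw using 2 with p
    rw [Real.rpow_neg (hpos p).le, div_eq_mul_inv]
    congr 1
    exact_mod_cast Complex.norm_natCast (p.2 + 1)

theorem continuousOn_expSum {a : ℝ} (ha : 0 < a) : ContinuousOn (expSum a) (Ioi 0) := by
  have h : ∀ b : ℝ, 0 < b → ContinuousOn (fun t : ℝ => (Real.exp (b * t) - 1)⁻¹) (Ioi 0) :=
    fun b hb => ContinuousOn.inv₀ (by fun_prop) fun t ht => by
      have : 1 < Real.exp (b * t) := by simpa using mul_pos hb ht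
      linarith
  have h1 := h 1 one_pos
  simp only [one_mul] at h1
  exact (h a ha).mul (h1.add (h1.pow 2))

theorem expSum_isBigO_atTop {a : ℝ} (ha : 1 ≤ a) :
    (fun t => (expSum a t : ℂ)) =O[atTop] fun t => Real.exp (-1 * t) := by
  refine Asymptotics.IsBigO.of_bound 6 ?_
  filter_upwards [eventually_ge_atTop (1 : ℝ)] with t ht
  have h1 : 2 ≤ Real.exp t := by linarith [Real.add_one_le_exp t]
  have h2 : Real.exp t ≤ Real.exp (a * t) := Real.exp_le_exp.2 (by nlinarith)
  have h3 : (Real.exp (a * t) - 1)⁻¹ ≤ 1 := inv_le_one_of_one_le₀ (by linarith)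
  have h4 : (Real.exp t - 1)⁻¹ ≤ 2 * (Real.exp t)⁻¹ := by
    rw [inv_le_comm₀ (by linarith) (by positivity), mul_inv, inv_inv]
    linarith
  have h5 : 0 ≤ (Real.exp t - 1)⁻¹ := inv_nonneg.2 (by linarith)
  have h6 : 0 ≤ (Real.exp (a * t) - 1)⁻¹ := inv_nonneg.2 (by linarith)
  have h7 : (Real.exp t - 1)⁻¹ ≤ 1 := inv_le_one_of_one_le₀ (by linarith)
  rw [Complex.norm_real, Real.norm_of_nonneg (by unfold expSum; positivity),
    Real.norm_of_nonneg (Real.exp_pos _).le, neg_one_mul, Real.exp_neg]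
  unfold expSum
  nlinarith [mul_nonneg h5 h5, mul_nonneg h5 h6, mul_nonneg (sub_nonneg.2 h7) h5,
    mul_le_mul_of_nonneg_right h3 (add_nonneg h5 (sq_nonneg (Real.exp t - 1)⁻¹))]

/-- The polar part at `w` integers `≤ 3` of `Γ(w) ∑ n (am+n)^{-w}`. -/
theorem exists_latticeSeries_continuation {a : ℝ} (ha : 1 ≤ a) :
    ∃ c : ℕ → ℂ, c 1 = -1 / 2 ∧ c 3 = 1 / 24 ∧ ∀ n : ℕ, 4 ≤ n → ∃ H : ℂ → ℂ,
      (∀ w : ℂ, 3 - (n : ℝ) < w.re → DifferentiableAt ℂ H w) ∧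
      ∀ w : ℂ, 3 < w.re → latticeSeries a w =
        (Gamma w)⁻¹ * (∑ j ∈ Finset.range n, c j / (w + ((j : ℂ) - 3)) + H w) := by
  have ha0 : 0 < a := by linarith
  obtain ⟨c, hc1, hc3, h⟩ := exists_expSum_expansion ha0
  refine ⟨fun j => (c j : ℂ), by simp [hc1], by simp [hc3], fun n hn => ?_⟩
  obtain ⟨h, hh, hexp⟩ := h n hn
  have hbot : (fun t : ℝ => (expSum a t : ℂ) -
      ∑ j ∈ Finset.range n, (c j : ℂ) * (t : ℂ) ^ ((j : ℂ) - (3 : ℕ)))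
      =O[𝓝[>] 0] fun t : ℝ => t ^ (-(((3 : ℕ) : ℝ) - n)) := by
    have hO : (fun t : ℝ => ((t ^ (-(((3 : ℕ) : ℝ) - n)) * h t : ℝ) : ℂ)) =O[𝓝[>] 0]
        fun t : ℝ => t ^ (-(((3 : ℕ) : ℝ) - n)) := by
      refine Asymptotics.IsBigO.of_norm_left ?_
      simp_rw [Complex.norm_real]
      refine Asymptotics.IsBigO.norm_left ?_
      simpa using (Asymptotics.isBigO_refl (fun t : ℝ => t ^ (-(((3 : ℕ) : ℝ) - n))) (𝓝[>] 0)).mul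
        ((hh.continuousAt.tendsto.isBigO_one ℝ).mono nhdsWithin_le_nhds)
    refine hO.congr' ?_ EventuallyEq.rfl
    filter_upwards [self_mem_nhdsWithin, nhdsWithin_le_nhds hexp] with t ht he
    have ht0 : (0 : ℝ) < t := ht
    have htc : (t : ℂ) ≠ 0 := by exact_mod_cast ht0.ne'
    have hE : expSum a t = ∑ j ∈ Finset.range n, c j * (t ^ j / t ^ 3) + t ^ n / t ^ 3 * h t := by
      have := he ht0
      simp_rw [← mul_div_assoc, ← Finset.sum_div]
      field_simp
      linarith
    rw [hE]
    have hp : t ^ (-(((3 : ℕ) : ℝ) - n)) = t ^ n / t ^ 3 := by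
      rw [neg_sub, Real.rpow_sub ht0, Real.rpow_natCast, Real.rpow_natCast]
    rw [hp]
    simp_rw [Complex.cpow_sub _ _ htc, Complex.cpow_natCast]
    push_cast
    ring
  obtain ⟨H, hH, hm⟩ := exists_mellin_continuation (φ := fun t => (expSum a t : ℂ))
    (Complex.continuous_ofReal.comp_continuousOn (continuousOn_expSum ha0)) one_pos
    (expSum_isBigO_atTop ha) hbot
  refine ⟨H, fun w hw => hH w (by simpa using hw), fun w hw => ?_⟩
  have hG : Gamma w ≠ 0 := Gamma_ne_zero_of_re_pos (by linarith)
  have := hm w (by simpa using hw)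
  rw [mellin_expSum ha hw] at this
  rw [eq_inv_mul_iff_mul_eq₀ hG, this]
  simp

/-- The coefficient of `uᵏ` in the binomial series of `(1 - u)^{-s}`. -/
noncomputable def binomCoeff (k : ℕ) (s : ℂ) : ℂ := ∏ i ∈ Finset.range k, (s + i) / (i + 1)

theorem binomCoeff_succ_mul (k : ℕ) (s : ℂ) :
    binomCoeff (k + 1) s * (k + 1) = s * binomCoeff k (s + 1) := by
  have hk : ∏ i ∈ Finset.range k, ((i : ℂ) + 1) ≠ 0 :=
    Finset.prod_ne_zero_iff.2 fun i _ => Nat.cast_add_one_ne_zero i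
  have hk' : (k : ℂ) + 1 ≠ 0 := Nat.cast_add_one_ne_zero k
  simp only [binomCoeff, Finset.prod_div_distrib]
  rw [Finset.prod_range_succ' (fun i : ℕ => s + (i : ℂ)), Finset.prod_range_succ]
  have : ∀ i : ℕ, s + ((i + 1 : ℕ) : ℂ) = s + 1 + i := fun i => by push_cast; ring
  simp_rw [this]
  field_simp
  simp [mul_comm]

theorem binomCoeff_succ_zero (k : ℕ) : binomCoeff (k + 1) 0 = 0 := by
  simp [binomCoeff, Finset.prod_range_succ']

theorem differentiable_binomCoeff (k : ℕ) : Differentiable ℂ (binomCoeff k) := by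
  unfold binomCoeff
  fun_prop

/-- The remainder of order `k` of the binomial series of `(1 - u)^{-s}`. -/
noncomputable def binomRem (k : ℕ) (s : ℂ) (u : ℝ) : ℂ :=
  ((1 - u : ℝ) : ℂ) ^ (-s) - ∑ j ∈ Finset.range k, binomCoeff j s * (u : ℂ) ^ j

theorem binomRem_succ_zero_left (k : ℕ) (u : ℝ) : binomRem (k + 1) 0 u = 0 := by
  rw [binomRem, Finset.sum_range_succ']
  simp [binomCoeff_succ_zero, show binomCoeff 0 0 = 1 by simp [binomCoeff]]

theorem binomRem_succ_zero_right (k : ℕ) (s : ℂ) : binomRem (k + 1) s 0 = 0 := by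
  simp [binomRem, Finset.sum_range_succ', binomCoeff]

theorem hasDerivAt_binomRem (k : ℕ) (s : ℂ) {u : ℝ} (hu : u < 1) :
    HasDerivAt (binomRem (k + 1) s) (s * binomRem k (s + 1) u) u := by
  have hid : HasDerivAt (fun u : ℝ => (u : ℂ)) 1 u := Complex.ofRealCLM.hasDerivAt
  have h1 : HasDerivAt (fun u : ℝ => ((1 - u : ℝ) : ℂ) ^ (-s))
      (s * ((1 - u : ℝ) : ℂ) ^ (-(s + 1))) u := by
    have := (((hasDerivAt_id (u : ℂ)).const_sub 1).cpow_const (c := -s) (Or.inl (by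
      simpa using hu))).comp_ofReal
    refine (this.congr_deriv ?_).congr_of_eventuallyEq ?_
    · push_cast; simp only [id]; ring_nf
    · exact Eventually.of_forall fun v => by push_cast; rfl
  have h2 : HasDerivAt (fun u : ℝ => ∑ j ∈ Finset.range (k + 1), binomCoeff j s * (u : ℂ) ^ j)
      (s * ∑ j ∈ Finset.range k, binomCoeff j (s + 1) * (u : ℂ) ^ j) u := by
    have := HasDerivAt.fun_sum (u := Finset.range (k + 1)) fun j _ =>
      (hid.pow j).const_mul (binomCoeff j s)
    refine this.congr_deriv ?_
    rw [Finset.sum_range_succ', Finset.mul_sum]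
    simp only [Nat.cast_zero, zero_mul, mul_zero, add_zero, Nat.add_sub_cancel, mul_one]
    refine Finset.sum_congr rfl fun j _ => ?_
    rw [← mul_assoc, ← mul_assoc, ← binomCoeff_succ_mul]
    push_cast; ring
  rw [binomRem, mul_sub]
  exact h1.sub h2

theorem exists_binomRem_bound (k : ℕ) (M : ℝ) : ∃ C : ℝ, 0 ≤ C ∧ ∀ s : ℂ, ‖s‖ ≤ M →
    ∀ u ∈ Icc (0 : ℝ) (1 / 4), ‖binomRem k s u‖ ≤ C * u ^ k := by
  induction k generalizing M with
  | zero =>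
    refine ⟨2 ^ M, by positivity, fun s hs u hu => ?_⟩
    have h1 : 1 / 2 ≤ 1 - u := by linarith [hu.2]
    simp only [binomRem, Finset.range_zero, Finset.sum_empty, sub_zero, pow_zero, mul_one]
    rw [Complex.norm_cpow_eq_rpow_re_of_pos (by linarith)]
    have hre : |s.re| ≤ M := (Complex.abs_re_le_norm s).trans hs
    calc (1 - u) ^ (-s).re ≤ (1 - u) ^ (-M) :=
          Real.rpow_le_rpow_of_exponent_ge (by linarith) (by linarith [hu.1])
            (by simpa using (le_abs_self _).trans hre)
      _ ≤ (1 / 2) ^ (-M) := Real.rpow_le_rpow_of_nonpos (by norm_num) h1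
            (by linarith [(abs_nonneg _).trans hre])
      _ = 2 ^ M := by rw [one_div, Real.inv_rpow (by norm_num), Real.rpow_neg (by norm_num), inv_inv]
  | succ k ih =>
    obtain ⟨C, hC, h⟩ := ih (M + 1)
    refine ⟨|M| * C, by positivity, fun s hs u hu => ?_⟩
    have hs1 : ‖s + 1‖ ≤ M + 1 := (norm_add_le _ _).trans (by simpa using hs)
    have := (convex_Icc (0 : ℝ) u).norm_image_sub_le_of_norm_hasDerivWithin_le
      (f := binomRem (k + 1) s) (f' := fun v => s * binomRem k (s + 1) v) (C := |M| * (C * u ^ k))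
      (fun v hv => (hasDerivAt_binomRem k s (by linarith [hv.2, hu.2])).hasDerivWithinAt)
      (fun v hv => by
        rw [norm_mul]
        gcongr
        · exact hs.trans (le_abs_self M)
        · refine (h _ hs1 v ⟨hv.1, hv.2.trans hu.2⟩).trans ?_
          gcongr
          · exact hv.1
          · exact hv.2)
      (left_mem_Icc.2 hu.1) (right_mem_Icc.2 hu.1)
    rw [binomRem_succ_zero_right, sub_zero, sub_zero, Real.norm_of_nonneg hu.1] at this
    exact this.trans_eq (by ring)

/-- The point `(am+n)^{-2}` at which the binomial series is evaluated. -/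
theorem latticePoint_sq_inv_mem {a : ℝ} (ha : 1 ≤ a) (p : ℕ × ℕ) :
    (latticePoint a p ^ 2)⁻¹ ∈ Icc (0 : ℝ) (1 / 4) := by
  have := two_le_latticePoint ha p
  refine ⟨by positivity, ?_⟩
  rw [inv_le_comm₀ (by positivity) (by norm_num)]
  nlinarith

theorem sq_sub_one_cpow {x : ℝ} (hx : 1 < x) (s : ℂ) :
    ((x : ℂ) ^ 2 - 1) ^ (-s) = (x : ℂ) ^ (-(2 * s)) * ((1 - (x ^ 2)⁻¹ : ℝ) : ℂ) ^ (-s) := by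
  have hx0 : 0 < x := by linarith
  have hu : (x ^ 2)⁻¹ ≤ 1 := inv_le_one_of_one_le₀ (by nlinarith)
  have h1 : (x : ℂ) ^ 2 - 1 = ((x * x : ℝ) : ℂ) * ((1 - (x ^ 2)⁻¹ : ℝ) : ℂ) := by
    norm_cast
    field_simp
  rw [h1, mul_cpow_ofReal_nonneg (by positivity) (by linarith), ofReal_mul,
    mul_cpow_ofReal_nonneg hx0.le hx0.le, ← cpow_add _ _ (by exact_mod_cast hx0.ne')]
  ring_nf

theorem sq_sub_one_cpow_eq_sum {x : ℝ} (hx : 1 < x) (k : ℕ) (s : ℂ) :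
    ((x : ℂ) ^ 2 - 1) ^ (-s) =
      ∑ j ∈ Finset.range k, binomCoeff j s * (x : ℂ) ^ (-(2 * s + 2 * j)) +
        (x : ℂ) ^ (-(2 * s)) * binomRem k s (x ^ 2)⁻¹ := by
  have hx0 : (x : ℂ) ≠ 0 := by exact_mod_cast (show x ≠ 0 by linarith)
  rw [sq_sub_one_cpow hx, binomRem, mul_sub, Finset.mul_sum]
  have : ∀ j : ℕ, (x : ℂ) ^ (-(2 * s + 2 * j)) =
      (x : ℂ) ^ (-(2 * s)) * (((x ^ 2)⁻¹ : ℝ) : ℂ) ^ j := fun j => by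
    rw [neg_add, cpow_add _ _ hx0, cpow_neg _ (2 * (j : ℂ)), ← Nat.cast_two, ← Nat.cast_mul,
      cpow_natCast, pow_mul, ofReal_inv, inv_pow, ofReal_pow]
  simp_rw [this]
  rw [← sub_eq_iff_eq_add']
  congr 1
  exact Finset.sum_congr rfl fun j _ => by ring

/-- The part of `∑ n ((am+n)² - 1)^{-s}` left after the first `k` terms of the binomial series. -/
noncomputable def remSeries (a : ℝ) (k : ℕ) (s : ℂ) : ℂ :=
  ∑' p : ℕ × ℕ, ((p.2 : ℂ) + 1) * (latticePoint a p : ℂ) ^ (-(2 * s)) *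
    binomRem k s (latticePoint a p ^ 2)⁻¹

theorem exists_remSeries_bound {a : ℝ} (ha : 1 ≤ a) (k : ℕ) (M : ℝ) : ∃ C : ℝ,
    ∀ s : ℂ, ‖s‖ ≤ M → 2 - (k : ℝ) ≤ s.re → ∀ p : ℕ × ℕ,
      ‖((p.2 : ℂ) + 1) * (latticePoint a p : ℂ) ^ (-(2 * s)) *
        binomRem k s (latticePoint a p ^ 2)⁻¹‖ ≤
      C * (((p.2 : ℝ) + 1) * latticePoint a p ^ (-4 : ℝ)) := by
  obtain ⟨C, hC, h⟩ := exists_binomRem_bound k M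
  refine ⟨C, fun s hs hre p => ?_⟩
  have hx := two_le_latticePoint ha p
  have hx0 : 0 < latticePoint a p := by linarith
  rw [norm_mul, norm_latticeSeries_term ha]
  have h1 : latticePoint a p ^ (-(2 * s).re) * ((latticePoint a p ^ 2)⁻¹) ^ k ≤
      latticePoint a p ^ (-4 : ℝ) := by
    have h2 : ((latticePoint a p ^ 2)⁻¹) ^ k = latticePoint a p ^ (-(2 * k : ℝ)) := by
      rw [Real.rpow_neg hx0.le, inv_pow, ← pow_mul, ← Real.rpow_natCast]
      push_cast; rfl
    rw [h2, ← Real.rpow_add hx0]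
    refine Real.rpow_le_rpow_of_exponent_le (by linarith) ?_
    simp
    linarith
  calc _ ≤ ((p.2 : ℝ) + 1) * latticePoint a p ^ (-(2 * s).re) *
        (C * ((latticePoint a p ^ 2)⁻¹) ^ k) := by
        gcongr
        exact h s hs _ (latticePoint_sq_inv_mem ha p)
    _ = C * (((p.2 : ℝ) + 1) *
        (latticePoint a p ^ (-(2 * s).re) * ((latticePoint a p ^ 2)⁻¹) ^ k)) := by ring
    _ ≤ _ := by gcongr

theorem summable_remSeries {a : ℝ} (ha : 1 ≤ a) {k : ℕ} {s : ℂ} (hs : 2 - (k : ℝ) ≤ s.re) :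
    Summable fun p : ℕ × ℕ => ((p.2 : ℂ) + 1) * (latticePoint a p : ℂ) ^ (-(2 * s)) *
      binomRem k s (latticePoint a p ^ 2)⁻¹ := by
  obtain ⟨C, h⟩ := exists_remSeries_bound ha k ‖s‖
  exact Summable.of_norm_bounded ((summable_latticePoint_rpow ha (by norm_num)).mul_left C)
    (h s le_rfl hs)

theorem differentiableAt_remSeries {a : ℝ} (ha : 1 ≤ a) {k : ℕ} {s : ℂ}
    (hs : 2 - (k : ℝ) < s.re) : DifferentiableAt ℂ (remSeries a k) s := by
  obtain ⟨C, h⟩ := exists_remSeries_bound ha k (‖s‖ + 1)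
  let V : Set ℂ := {z | 2 - (k : ℝ) < z.re} ∩ Metric.ball 0 (‖s‖ + 1)
  have hV : IsOpen V := (isOpen_lt continuous_const continuous_re).inter Metric.isOpen_ball
  have hsV : s ∈ V := ⟨hs, by simp⟩
  refine (differentiableOn_tsum_of_summable_norm (U := V)
    ((summable_latticePoint_rpow ha (show (3 : ℝ) < 4 by norm_num)).mul_left C) (fun p => ?_) hV
    fun p z hz => h z (by simpa using (mem_ball_zero_iff.1 hz.2).le) hz.1.le
      p).differentiableAt (hV.mem_nhds hsV)
  have hx := two_le_latticePoint ha p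
  have hu := latticePoint_sq_inv_mem ha p
  have hx0 : (latticePoint a p : ℂ) ≠ 0 := by exact_mod_cast (show latticePoint a p ≠ 0 by linarith)
  have hu0 : ((1 - (latticePoint a p ^ 2)⁻¹ : ℝ) : ℂ) ≠ 0 := by
    exact_mod_cast (show 1 - (latticePoint a p ^ 2)⁻¹ ≠ 0 by linarith [hu.2])
  refine Differentiable.differentiableOn ?_
  have h1 : Differentiable ℂ fun z : ℂ => (latticePoint a p : ℂ) ^ (-(2 * z)) :=
    fun z => DifferentiableAt.const_cpow (by fun_prop) (Or.inl hx0)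
  have h2 : Differentiable ℂ fun z : ℂ => ((1 - (latticePoint a p ^ 2)⁻¹ : ℝ) : ℂ) ^ (-z) :=
    fun z => DifferentiableAt.const_cpow (by fun_prop) (Or.inl hu0)
  refine (h1.const_mul _).mul (h2.sub (Differentiable.fun_sum fun j _ => ?_))
  exact (differentiable_binomCoeff j).mul_const _

theorem remSeries_succ_zero (a : ℝ) (k : ℕ) : remSeries a (k + 1) 0 = 0 := by
  simp [remSeries, binomRem_succ_zero_left]

theorem ofReal_latticePoint (a : ℝ) (p : ℕ × ℕ) :
    (latticePoint a p : ℂ) = (a : ℂ) * (p.1 + 1) + ((p.2 : ℂ) + 1) := by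
  simp [latticePoint]

theorem hasSum_series {a : ℝ} (ha : 1 ≤ a) (k : ℕ) {s : ℂ} (hs : 2 < s.re) :
    HasSum (fun p : ℕ × ℕ =>
      ((p.2 : ℂ) + 1) * (((a : ℂ) * (p.1 + 1) + ((p.2 : ℂ) + 1)) ^ 2 - 1) ^ (-s))
      (∑ j ∈ Finset.range k, binomCoeff j s * latticeSeries a (2 * s + 2 * j)
        + remSeries a k s) := by
  have hk := k.cast_nonneg (α := ℝ)
  have h1 := hasSum_sum (s := Finset.range k) fun j _ =>
    ((summable_latticeSeries ha (w := 2 * s + 2 * j) (by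
      have := j.cast_nonneg (α := ℝ)
      simp; linarith)).hasSum).mul_left (binomCoeff j s)
  have h2 := h1.add (summable_remSeries ha (k := k) (s := s) (by linarith)).hasSum
  have he : ∀ p : ℕ × ℕ,
      ((p.2 : ℂ) + 1) * (((a : ℂ) * (p.1 + 1) + ((p.2 : ℂ) + 1)) ^ 2 - 1) ^ (-s) =
        ∑ j ∈ Finset.range k, binomCoeff j s *
          (((p.2 : ℂ) + 1) * (latticePoint a p : ℂ) ^ (-(2 * s + 2 * j))) +
        ((p.2 : ℂ) + 1) * (latticePoint a p : ℂ) ^ (-(2 * s)) *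
          binomRem k s (latticePoint a p ^ 2)⁻¹ := fun p => by
    rw [← ofReal_latticePoint, sq_sub_one_cpow_eq_sum (by linarith [two_le_latticePoint ha p]) k,
      mul_add, Finset.mul_sum, mul_assoc]
    congr 1
    exact Finset.sum_congr rfl fun j _ => by ring
  simp_rw [he]
  exact h2

theorem summable_norm_series {a : ℝ} (ha : 1 ≤ a) {s : ℂ} (hs : 2 < s.re) :
    Summable (fun p : ℕ × ℕ =>
      ‖((p.2 : ℂ) + 1) * (((a : ℂ) * (p.1 + 1) + ((p.2 : ℂ) + 1)) ^ 2 - 1) ^ (-s)‖) :=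
  (hasSum_series ha 0 hs).summable.norm

theorem tendsto_mul_div_zero (c : ℂ) (k i : ℕ) :
    Tendsto (fun s : ℂ => s * (c / (2 * s + 2 * k + ((i : ℂ) - 3)))) (𝓝[≠] 0)
      (𝓝 (if 2 * k + i = 3 then c / 2 else 0)) := by
  split_ifs with h
  · have h' : 2 * (k : ℂ) + i = 3 := by exact_mod_cast h
    refine tendsto_const_nhds.congr' ?_
    filter_upwards [self_mem_nhdsWithin] with s hs
    have hs : s ≠ 0 := hs
    rw [show 2 * s + 2 * k + ((i : ℂ) - 3) = 2 * s by linear_combination h']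
    field_simp
  · have h' : 2 * (k : ℂ) + (i - 3) ≠ 0 := fun h0 => h (by
      have : 2 * (k : ℂ) + i = 3 := by linear_combination h0
      exact_mod_cast this)
    have : ContinuousAt (fun s : ℂ => s * (c / (2 * s + 2 * k + ((i : ℂ) - 3)))) 0 := by
      refine continuousAt_id.mul (continuousAt_const.div (by fun_prop) ?_)
      simpa using h'
    simpa using this.tendsto.mono_left nhdsWithin_le_nhds

theorem tendsto_mul_polar (c : ℕ → ℂ) {n : ℕ} {H : ℂ → ℂ} (k : ℕ) (hH : ContinuousAt H (2 * k)) :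
    Tendsto (fun s : ℂ => s * (∑ i ∈ Finset.range n, c i / (2 * s + 2 * k + ((i : ℂ) - 3)) +
      H (2 * s + 2 * k))) (𝓝[≠] 0)
      (𝓝 (∑ i ∈ Finset.range n, if 2 * k + i = 3 then c i / 2 else 0)) := by
  have h1 : ContinuousAt (fun s : ℂ => s * H (2 * s + 2 * k)) 0 :=
    continuousAt_id.mul (ContinuousAt.comp (g := H) (f := fun s : ℂ => 2 * s + 2 * k)
      (by simpa using hH) (by fun_prop))
  have h2 := (tendsto_finsetSum (Finset.range n)
    fun i _ => tendsto_mul_div_zero (c i) k i).add (h1.tendsto.mono_left nhdsWithin_le_nhds)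
  simpa only [zero_mul, add_zero, mul_add, Finset.mul_sum] using h2

theorem continuous_Gamma_inv : Continuous fun s : ℂ => (Gamma s)⁻¹ := by
  simpa using differentiable_one_div_Gamma.continuous

theorem tendsto_term_zero {P : ℂ → ℂ} {L : ℂ}
    (hP : Tendsto (fun s : ℂ => s * P s) (𝓝[≠] 0) (𝓝 L)) :
    Tendsto (fun s : ℂ => (Gamma (2 * s))⁻¹ * P s) (𝓝[≠] 0) (𝓝 (2 * L)) := by
  have h1 : Continuous fun s : ℂ => 2 * (Gamma (2 * s + 1))⁻¹ :=
    continuous_const.mul (continuous_Gamma_inv.comp (by fun_prop : Continuous fun s : ℂ => 2 * s + 1))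
  have h2 := ((h1.tendsto 0).mono_left nhdsWithin_le_nhds).mul hP
  simp only [mul_zero, zero_add, Gamma_one, inv_one, mul_one] at h2
  refine h2.congr fun s => ?_
  have := one_div_Gamma_eq_self_mul_one_div_Gamma_add_one (2 * s)
  rw [this]
  ring

theorem tendsto_term_succ (k : ℕ) {P : ℂ → ℂ} {L : ℂ}
    (hP : Tendsto (fun s : ℂ => s * P s) (𝓝[≠] 0) (𝓝 L)) :
    Tendsto (fun s : ℂ => binomCoeff (k + 1) s *
      ((Gamma (2 * s + 2 * (k + 1 : ℕ)))⁻¹ * P s)) (𝓝[≠] 0)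
      (𝓝 (binomCoeff k 1 / (k + 1) * (Gamma (2 * (k + 1 : ℕ)))⁻¹ * L)) := by
  have h1 : Continuous fun s : ℂ => binomCoeff k (s + 1) / (k + 1) *
      (Gamma (2 * s + 2 * (k + 1 : ℕ)))⁻¹ := by
    refine Continuous.mul (Continuous.div_const ?_ _) ?_
    · exact (differentiable_binomCoeff k).continuous.comp (by fun_prop)
    · exact continuous_Gamma_inv.comp
        (by fun_prop : Continuous fun s : ℂ => 2 * s + 2 * (k + 1 : ℕ))
  have h2 := ((h1.tendsto 0).mono_left nhdsWithin_le_nhds).mul hP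
  simp only [mul_zero, zero_add] at h2
  refine h2.congr fun s => ?_
  have := binomCoeff_succ_mul k s
  have hk : (k : ℂ) + 1 ≠ 0 := Nat.cast_add_one_ne_zero k
  rw [eq_div_of_mul_eq hk this]
  ring

theorem exists_meromorphic_continuation {a : ℝ} (ha : 1 ≤ a) (m : ℕ) : ∃ G : ℂ → ℂ,
    MeromorphicOn G {s | -(m : ℝ) - 1 < s.re} ∧
    Tendsto G (𝓝[≠] 0) (𝓝 (-(5 / 24))) ∧
    ∀ s : ℂ, 2 < s.re → G s = ∑' p : ℕ × ℕ,
      ((p.2 : ℂ) + 1) * (((a : ℂ) * (p.1 + 1) + ((p.2 : ℂ) + 1)) ^ 2 - 1) ^ (-s) := by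
  obtain ⟨c, hc1, hc3, hc⟩ := exists_latticeSeries_continuation ha
  obtain ⟨H, hH, hW⟩ := hc (2 * m + 6) (by lia)
  push_cast at hH
  let P : ℕ → ℂ → ℂ := fun k s => ∑ i ∈ Finset.range (2 * m + 6),
    c i / (2 * s + 2 * k + ((i : ℂ) - 3)) + H (2 * s + 2 * k)
  have hP : ∀ k : ℕ, Tendsto (fun s : ℂ => s * P k s) (𝓝[≠] 0)
      (𝓝 (∑ i ∈ Finset.range (2 * m + 6), if 2 * k + i = 3 then c i / 2 else 0)) := fun k =>
    tendsto_mul_polar c k (hH _ (by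
      have := k.cast_nonneg (α := ℝ)
      have := m.cast_nonneg (α := ℝ)
      simp; linarith)).continuousAt
  let T : ℕ → ℂ → ℂ := fun k s => binomCoeff k s * ((Gamma (2 * s + 2 * k))⁻¹ * P k s)
  have hT0 : Tendsto (T 0) (𝓝[≠] 0) (𝓝 (1 / 24)) := by
    have h := tendsto_term_zero (hP 0)
    rw [Finset.sum_eq_single_of_mem 3 (by simp) (fun i _ hi => if_neg (by lia)), if_pos rfl, hc3,
      mul_div_cancel₀ _ two_ne_zero] at h
    simpa [T, binomCoeff] using h
  have hT1 : Tendsto (T 1) (𝓝[≠] 0) (𝓝 (-1 / 4)) := by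
    have h := tendsto_term_succ 0 (hP 1)
    rw [Finset.sum_eq_single_of_mem 1 (by simp) (fun i _ hi => if_neg (by lia)), if_pos rfl, hc1]
      at h
    convert h using 2
    simp [binomCoeff]
    norm_num
  have hT2 : ∀ k, Tendsto (T (k + 2)) (𝓝[≠] 0) (𝓝 0) := fun k => by
    have h := tendsto_term_succ (k + 1) (hP (k + 2))
    rw [Finset.sum_eq_zero (fun i _ => if_neg (by lia)), mul_zero] at h
    exact h
  have hR : ∀ s : ℂ, -(m : ℝ) - 1 < s.re → DifferentiableAt ℂ (remSeries a (m + 3)) s :=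
    fun s hs => differentiableAt_remSeries ha (by push_cast; linarith)
  refine ⟨fun s => ∑ k ∈ Finset.range (m + 3), T k s + remSeries a (m + 3) s, fun s hs => ?_, ?_,
    fun s hs => ?_⟩
  · have hopen : IsOpen {s : ℂ | -(m : ℝ) - 1 < s.re} := isOpen_lt continuous_const continuous_re
    have hmer : ∀ f : ℂ → ℂ, (∀ z : ℂ, -(m : ℝ) - 1 < z.re → DifferentiableAt ℂ f z) →
        MeromorphicAt f s := fun f hf =>
      (DifferentiableOn.analyticAt (fun z hz => (hf z hz).differentiableWithinAt)
        (hopen.mem_nhds hs)).meromorphicAt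
    refine MeromorphicAt.fun_add (MeromorphicAt.fun_sum fun k _ => ?_) (hmer _ hR)
    refine MeromorphicAt.fun_mul (hmer _ fun z _ => differentiable_binomCoeff k z)
      (MeromorphicAt.fun_mul (hmer _ fun z _ => ?_) (MeromorphicAt.fun_add
        (MeromorphicAt.fun_sum fun i _ => ?_) (hmer _ fun z hz => ?_)))
    · have := differentiable_one_div_Gamma.comp
        (by fun_prop : Differentiable ℂ fun z : ℂ => 2 * z + 2 * k)
      simpa [Function.comp_def] using this z
    · exact MeromorphicAt.fun_div (hmer _ fun z _ => by fun_prop) (hmer _ fun z _ => by fun_prop)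
    · refine DifferentiableAt.comp (g := H) z (hH _ ?_) (by fun_prop)
      have := k.cast_nonneg (α := ℝ)
      simp; linarith
  · have h1 := (hR 0 (by have := m.cast_nonneg (α := ℝ); simp; linarith)).continuousAt.tendsto
    rw [remSeries_succ_zero] at h1
    have h2 := ((((tendsto_finsetSum (Finset.range (m + 1)) fun k _ => hT2 k).add hT1).add hT0).add
      (h1.mono_left nhdsWithin_le_nhds))
    simp_rw [Finset.sum_range_succ' _ (m + 2), Finset.sum_range_succ' _ (m + 1)]
    convert h2 using 2
    simp
    norm_num
  · rw [(hasSum_series ha (m + 3) hs).tsum_eq, add_left_inj]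
    refine Finset.sum_congr rfl fun k _ => ?_
    rw [hW]
    have := k.cast_nonneg (α := ℝ)
    simp; linarith

/-- Identity principle: an analytic continuation along a connected open set agrees with the
meromorphic continuations to half-planes. -/
theorem IsContinuationAt.eq_of_meromorphic {F f : ℂ → ℂ} {c : ℝ} {s₀ L : ℂ}
    (hf : IsContinuationAt F c s₀ f)
    (h : ∀ m : ℕ, ∃ G : ℂ → ℂ, MeromorphicOn G {s | -(m : ℝ) - 1 < s.re} ∧
      Tendsto G (𝓝[≠] s₀) (𝓝 L) ∧ ∀ s : ℂ, c < s.re → G s = F s) : f s₀ = L := by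
  obtain ⟨U, hU, hUc, h0, hcU, hfU, hfF⟩ := hf
  have hs₁ : c < ((c + 1 : ℝ) : ℂ).re := by simp
  obtain ⟨γ, hγ⟩ := (hU.isConnected_iff_isPathConnected.1 hUc).joinedIn s₀ h0
    ((c + 1 : ℝ) : ℂ) (hcU hs₁)
  obtain ⟨b, hb⟩ := (isCompact_range (continuous_re.comp γ.continuous)).bddBelow
  obtain ⟨m, hm⟩ := exists_nat_gt (-b)
  obtain ⟨G, hG, hGL, hGF⟩ := h m
  let V : Set ℂ := U ∩ {s | -(m : ℝ) - 1 < s.re}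
  have hγV : range γ ⊆ V := by
    rintro _ ⟨t, rfl⟩
    refine ⟨hγ t, ?_⟩
    have : b ≤ (γ t).re := hb ⟨t, rfl⟩
    simp only [mem_ofPred_eq]
    linarith
  have h0V : s₀ ∈ range γ := ⟨0, γ.source⟩
  have h1V : ((c + 1 : ℝ) : ℂ) ∈ range γ := ⟨1, γ.target⟩
  have hsub : range γ ⊆ connectedComponentIn V s₀ :=
    (isPreconnected_range γ.continuous).subset_connectedComponentIn h0V hγV
  have hmer : MeromorphicOn (fun s => f s - G s) (connectedComponentIn V s₀) := fun s hs => by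
    have hs' := connectedComponentIn_subset V s₀ hs
    exact (hfU s hs'.1).meromorphicAt.fun_sub (hG s hs'.2)
  have htop : meromorphicOrderAt (fun s => f s - G s) s₀ = ⊤ := by
    by_contra hne
    refine hmer.meromorphicOrderAt_ne_top_of_isPreconnected isPreconnected_connectedComponentIn
      (hsub h0V) (hsub h1V) hne (meromorphicOrderAt_eq_top_iff.2 (nhdsWithin_le_nhds ?_))
    filter_upwards [(isOpen_lt continuous_const continuous_re).mem_nhds hs₁] with s hs
    rw [hfF s hs, hGF s hs, sub_self]
  have heq : ∀ᶠ s in 𝓝[≠] s₀, G s = f s := (meromorphicOrderAt_eq_top_iff.1 htop).mono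
    fun s hs => (sub_eq_zero.1 hs).symm
  exact tendsto_nhds_unique
    ((hfU s₀ h0).continuousAt.tendsto.mono_left nhdsWithin_le_nhds) (hGL.congr' heq)

end LatticeZeta

/-- for `a ≥ 1`, the double series
`Z(s) = ∑_{m,n≥1} n·((am+n)² − 1)^{-s}` converges absolutely for `Re s > 2`, and every
analytic continuation `f` of this series to `0` satisfies `f(0) = −5/24` (independently
of `a`). -/
theorem stmt10 (a : ℝ) (ha : 1 ≤ a) :
    (∀ s : ℂ, 2 < s.re →
      Summable (fun p : ℕ × ℕ =>
        ‖((p.2 : ℂ) + 1) * (((a : ℂ) * (p.1 + 1) + ((p.2 : ℂ) + 1)) ^ 2 - 1) ^ (-s)‖)) ∧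
    ∀ f : ℂ → ℂ,
      IsContinuationAt
        (fun s => ∑' (m : ℕ) (n : ℕ),
          ((n : ℂ) + 1) * (((a : ℂ) * (m + 1) + ((n : ℂ) + 1)) ^ 2 - 1) ^ (-s)) 2 0 f →
      f 0 = -(5 / 24) := by
  refine ⟨fun s hs => summable_norm_series ha hs, fun f hf => hf.eq_of_meromorphic fun m => ?_⟩
  obtain ⟨G, hG, hGL, hGF⟩ := exists_meromorphic_continuation ha m
  refine ⟨G, hG, hGL, fun s hs => ?_⟩
  rw [hGF s hs, (summable_norm_series ha hs).of_norm.tsum_prod]
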